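/- If a Z-viable semigroup X (i.e. every central idempotent of X is viable: E(X) ∩ Z(X) ⊆ VE(X)) is absolutely T₁S-closed, then its center Z(X) is finite. -/

import Mathlib

universe u

open Set TopologicalSpace

/-- A topological space is zero-dimensional: it has a base of clopen sets. -/
def HasClopenBasis (Y : Type*) [TopologicalSpace Y] : Prop :=
  ∃ B : Set (Set Y), (∀ s ∈ B, IsClopen s) ∧ IsTopologicalBasis B

section TopClasses

variable (X : Type u) [Semigroup X]

/-- `X` is absolutely `T₁S`-closed: the image of every homomorphism to a `T₁`
topological semigroup is closed. -/
def AbsolutelyT1SClosed : Prop :=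
  ∀ (Y : Type u) [Semigroup Y] [TopologicalSpace Y] [ContinuousMul Y] [T1Space Y]
    (h : X →ₙ* Y), IsClosed (Set.range h)

/-- `X` is absolutely `T₂S`-closed. -/
def AbsolutelyT2SClosed : Prop :=
  ∀ (Y : Type u) [Semigroup Y] [TopologicalSpace Y] [ContinuousMul Y] [T2Space Y]
    (h : X →ₙ* Y), IsClosed (Set.range h)

/-- `X` is absolutely `TzS`-closed. -/
def AbsolutelyTzSClosed : Prop :=
  ∀ (Y : Type u) [Semigroup Y] [TopologicalSpace Y] [ContinuousMul Y] [T1Space Y],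
    HasClopenBasis Y → ∀ (h : X →ₙ* Y), IsClosed (Set.range h)

/-- `X` is `T₁S`-closed: the image of every injective homomorphism to a `T₁`
topological semigroup with discrete image is closed. -/
def T1SClosed : Prop :=
  ∀ (Y : Type u) [Semigroup Y] [TopologicalSpace Y] [ContinuousMul Y] [T1Space Y]
    (h : X →ₙ* Y), Function.Injective h → DiscreteTopology (Set.range h) →
      IsClosed (Set.range h)

/-- `X` is `T₂S`-closed. -/
def T2SClosed : Prop :=
  ∀ (Y : Type u) [Semigroup Y] [TopologicalSpace Y] [ContinuousMul Y] [T2Space Y]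
    (h : X →ₙ* Y), Function.Injective h → DiscreteTopology (Set.range h) →
      IsClosed (Set.range h)

/-- `X` is `TzS`-closed. -/
def TzSClosed : Prop :=
  ∀ (Y : Type u) [Semigroup Y] [TopologicalSpace Y] [ContinuousMul Y] [T1Space Y],
    HasClopenBasis Y → ∀ (h : X →ₙ* Y), Function.Injective h →
      DiscreteTopology (Set.range h) → IsClosed (Set.range h)

/-- `X` is injectively `T₂S`-closed. -/
def InjectivelyT2SClosed : Prop :=
  ∀ (Y : Type u) [Semigroup Y] [TopologicalSpace Y] [ContinuousMul Y] [T2Space Y]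
    (h : X →ₙ* Y), Function.Injective h → IsClosed (Set.range h)

/-- `X` is projectively `T₁S`-closed: all congruence quotients are `T₁S`-closed. -/
def ProjectivelyT1SClosed : Prop := ∀ c : Con X, T1SClosed c.Quotient

/-- `X` is projectively `TzS`-closed. -/
def ProjectivelyTzSClosed : Prop := ∀ c : Con X, TzSClosed c.Quotient

/-- `X` is projectively `T₁S`-discrete: every homomorphism into a `T₁`
topological semigroup has discrete image. -/
def ProjectivelyT1SDiscrete : Prop :=
  ∀ (Y : Type u) [Semigroup Y] [TopologicalSpace Y] [ContinuousMul Y] [T1Space Y]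
    (h : X →ₙ* Y), DiscreteTopology (Set.range h)

/-- `X` is projectively `TzS`-discrete. -/
def ProjectivelyTzSDiscrete : Prop :=
  ∀ (Y : Type u) [Semigroup Y] [TopologicalSpace Y] [ContinuousMul Y] [T1Space Y],
    HasClopenBasis Y → ∀ (h : X →ₙ* Y), DiscreteTopology (Set.range h)

end TopClasses

/-- `spow x n` is the power `x^(n+1)` in a semigroup; thus as `n` ranges over `ℕ`,
`spow x n` ranges over all powers `x^m`, `m ≥ 1`. -/
def spow {X : Type*} [Semigroup X] (x : X) : ℕ → X
  | 0 => x
  | n + 1 => spow x n * x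

section AlgDefs

variable (X : Type*) [Semigroup X]

/-- the set `E(X)` of idempotents. -/
def idemSet : Set X := {x | x * x = x}

/-- `H_e`, the maximal subgroup containing the idempotent `e`. -/
def maxSubgroup (e : X) : Set X :=
  {x | x * e = x ∧ e * x = x ∧ ∃ y, y * e = y ∧ e * y = y ∧ x * y = e ∧ y * x = e}

/-- The Clifford part `H(X) = ⋃_{e ∈ E(X)} H_e`. -/
def cliffordPart : Set X := ⋃ e ∈ idemSet X, maxSubgroup X e

/-- `H_e/e := {x : xe = ex ∈ H_e}`. -/
def HeCoideal (e : X) : Set X := {x | x * e = e * x ∧ x * e ∈ maxSubgroup X e}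

/-- `I` is an ideal of the semigroup `X`. -/
def IsIdealSet (I : Set X) : Prop := ∀ x ∈ I, ∀ y : X, x * y ∈ I ∧ y * x ∈ I

/-- The set `VE(X)` of viable idempotents: `e` is idempotent and `X ∖ (H_e/e)` is an ideal. -/
def viableIdems : Set X := {e | e ∈ idemSet X ∧ IsIdealSet X (Set.univ \ HeCoideal X e)}

/-- The center `Z(X)`. -/
def centerSet : Set X := {z | ∀ x, z * x = x * z}

/-- `√A = {x : xⁿ ∈ A for some n ≥ 1}`. -/
def sqrtSet (A : Set X) : Set X := {x | ∃ n : ℕ, spow x n ∈ A}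

/-- A subset `B ⊆ X` is bounded: there is `n ≥ 1` with `xⁿ` idempotent for all `x ∈ B`. -/
def BoundedSet (B : Set X) : Prop := ∃ n : ℕ, ∀ x ∈ B, spow x n ∈ idemSet X

/-- The semigroup `X` is bounded. -/
def BoundedSemigroup : Prop := ∃ n : ℕ, ∀ x : X, spow x n ∈ idemSet X

/-- `X` is chain-finite. -/
def ChainFinite : Prop :=
  ∀ I : Set X, I.Infinite → ∃ x ∈ I, ∃ y ∈ I, x * y ≠ x ∧ x * y ≠ y

/-- `G ⊆ X` is a subgroup of the semigroup `X`. -/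
def IsSubgroupSet (G : Set X) : Prop :=
  (∀ x ∈ G, ∀ y ∈ G, x * y ∈ G) ∧
    ∃ e ∈ G, (∀ x ∈ G, x * e = x ∧ e * x = x) ∧ ∀ x ∈ G, ∃ y ∈ G, x * y = e ∧ y * x = e

/-- `X` is group-finite: all its subgroups are finite. -/
def GroupFinite : Prop := ∀ G : Set X, IsSubgroupSet X G → G.Finite

/-- `X` is Clifford+finite: `X ∖ H(X)` is finite. -/
def CliffordPlusFinite : Prop := (Set.univ \ cliffordPart X).Finite

/-- `X` is `E`-commutative: idempotents commute. -/
def ECommutative : Prop := ∀ x ∈ idemSet X, ∀ y ∈ idemSet X, x * y = y * x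

end AlgDefs

/-- The Rees congruence associated with an ideal `I` of `X`. -/
def ReesCon {X : Type*} [Semigroup X] (I : Set X) (hI : IsIdealSet X I) : Con X where
  r x y := x = y ∨ (x ∈ I ∧ y ∈ I)
  iseqv :=
    { refl := fun _ => Or.inl rfl
      symm := by rintro x y (rfl | ⟨h1, h2⟩); exacts [Or.inl rfl, Or.inr ⟨h2, h1⟩]
      trans := by
        rintro x y z (rfl | ⟨h1, h2⟩) (rfl | ⟨h3, h4⟩)
        exacts [Or.inl rfl, Or.inr ⟨h3, h4⟩, Or.inr ⟨h1, h2⟩, Or.inr ⟨h1, h4⟩] }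
  mul' := by
    rintro a b c d (rfl | ⟨h1, h2⟩) (rfl | ⟨h3, h4⟩)
    · exact Or.inl rfl
    · exact Or.inr ⟨(hI c h3 a).2, (hI d h4 a).2⟩
    · exact Or.inr ⟨(hI a h1 c).1, (hI b h2 c).1⟩
    · exact Or.inr ⟨(hI a h1 c).1, (hI b h2 d).1⟩

/-- `X` is ideally `T₂S`-closed: all its Rees quotients are `T₂S`-closed. -/
def IdeallyT2SClosed (X : Type u) [Semigroup X] : Prop :=
  ∀ (I : Set X) (hI : IsIdealSet X I), T2SClosed (ReesCon I hI).Quotient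

/-- `X` is ideally `TzS`-closed. -/
def IdeallyTzSClosed (X : Type u) [Semigroup X] : Prop :=
  ∀ (I : Set X) (hI : IsIdealSet X I), TzSClosed (ReesCon I hI).Quotient

/-- A congruence is a semilattice congruence if its quotient is a commutative
semigroup of idempotents. -/
def IsSemilatticeCon {X : Type*} [Semigroup X] (c : Con X) : Prop :=
  (∀ a b : c.Quotient, a * b = b * a) ∧ ∀ a : c.Quotient, a * a = a

/-- The smallest semilattice congruence `⇕` on `X`, the intersection of all
semilattice congruences. -/
def slCon (X : Type*) [Semigroup X] : Con X := sInf {c | IsSemilatticeCon c}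

theorem centerSet_mul_mem {X : Type*} [Semigroup X] {a b : X}
    (ha : a ∈ centerSet X) (hb : b ∈ centerSet X) : a * b ∈ centerSet X := fun t => by
  rw [mul_assoc, hb t, ← mul_assoc, ha t, mul_assoc]

/-- The ideal center `IZ(X) = {z ∈ Z(X) : zX ⊆ Z(X)}`, as a subsemigroup of `X`. -/
def idealCenter (X : Type*) [Semigroup X] : Subsemigroup X where
  carrier := {z | z ∈ centerSet X ∧ ∀ x : X, z * x ∈ centerSet X}
  mul_mem' := by
    rintro a b ⟨ha, ha'⟩ ⟨hb, hb'⟩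
    refine ⟨centerSet_mul_mem ha hb, fun x => ?_⟩
    have h : a * b * x = a * (b * x) := mul_assoc a b x
    rw [h]
    exact centerSet_mul_mem ha (hb' x)

/-- Evaluation of the semigroup polynomial with coefficients `a, l = [a₁, …, aₙ]`:
`x ↦ a * x * a₁ * x * ⋯ * x * aₙ` (computed in `X¹ = WithOne X`). -/
def polyEval {X : Type*} [Semigroup X] (a : WithOne X) (l : List (WithOne X)) (x : X) :
    WithOne X :=
  l.foldl (fun acc b => acc * (x : WithOne X) * b) a

/-- `f : X → X¹` is a semigroup polynomial of degree `d ≥ 1`. -/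
def IsSemigroupPolynomial {X : Type*} [Semigroup X] (f : X → WithOne X) (d : ℕ) : Prop :=
  1 ≤ d ∧ ∃ (a : WithOne X) (l : List (WithOne X)), l.length = d ∧ ∀ x, f x = polyEval a l x

/-- `X` is polybounded. -/
def Polybounded (X : Type*) [Semigroup X] : Prop :=
  ∃ (k : ℕ) (f : Fin k → X → WithOne X) (d : Fin k → ℕ) (b : Fin k → X),
    (∀ i, IsSemigroupPolynomial (f i) (d i)) ∧ ∀ x : X, ∃ i, f i x = (b i : WithOne X)

/-- `X` is polyfinite. -/
def Polyfinite (X : Type*) [Semigroup X] : Prop :=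
  ∃ (d : ℕ) (F : Set X), F.Finite ∧ ∀ x y : X,
    ∃ (f : X → WithOne X) (m : ℕ), m ≤ d ∧ IsSemigroupPolynomial f m ∧
      (∃ u ∈ F, f x = (u : WithOne X)) ∧ ∃ v ∈ F, f y = (v : WithOne X)

/-- `X` is `B`-centrobounded over `B ⊆ E(X)`: there is `n ≥ 1` such that for every
`e ∈ B` and all `x, y ∈ ⋂_{a ∈ B} H_a/a`, if `w` is the inverse of `y*e` in the group
`H_e` and `(x*e)*w ∈ H_e ∩ Z(X)`, then `((x*e)*w)ⁿ` is an idempotent. -/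
def Centrobounded {X : Type*} [Semigroup X] (B : Set X) : Prop :=
  ∃ n : ℕ, ∀ e ∈ B, ∀ x ∈ ⋂ a ∈ B, HeCoideal X a, ∀ y ∈ ⋂ a ∈ B, HeCoideal X a,
    ∀ w ∈ maxSubgroup X e, (y * e) * w = e → w * (y * e) = e →
      (x * e) * w ∈ maxSubgroup X e → (x * e) * w ∈ centerSet X →
        spow ((x * e) * w) n ∈ idemSet X

/-- `B` is an antichain in the natural partial order `e ≤ f ⇔ ef = fe = e` on idempotents. -/
def IsIdemAntichain {X : Type*} [Semigroup X] (B : Set X) : Prop :=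
  ∀ e ∈ B, ∀ f ∈ B, e ≠ f → ¬(e * f = e ∧ f * e = e) ∧ ¬(e * f = f ∧ f * e = f)

open Filter Topology

section Charts

variable {Y : Type*}

/-- The set `Y × Bool`, to be topologized by gluing two copies of `Y` along `Tᶜ`. -/
def GluedDouble (_T : Set Y) := Y × Bool

namespace GluedDouble

variable {T : Set Y}

open Classical in
/-- The two copies of `Y` inside the double, which agree exactly off `T`. -/
noncomputable def chart (T : Set Y) (b : Bool) (y : Y) : GluedDouble T :=
  (y, b && decide (y ∈ T))

/-- The projection of the double onto `Y`. -/
def proj (p : GluedDouble T) : Y := p.1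

theorem chart_injective (b : Bool) : Function.Injective (chart T b) :=
  fun _ _ h => congrArg Prod.fst h

theorem chart_false_eq_chart_true {x y : Y} :
    chart T false x = chart T true y ↔ x = y ∧ y ∉ T :=
  Prod.ext_iff.trans (by simp [chart])

noncomputable instance [TopologicalSpace Y] : TopologicalSpace (GluedDouble T) :=
  ⨆ b, TopologicalSpace.coinduced (chart T b) inferInstance

theorem isOpen_iff [TopologicalSpace Y] {U : Set (GluedDouble T)} :
    IsOpen U ↔ ∀ b, IsOpen (chart T b ⁻¹' U) := by
  exact isOpen_iSup_iff

theorem continuous_chart [TopologicalSpace Y] (b : Bool) : Continuous (chart T b) :=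
  ⟨fun _ hU => isOpen_iff.1 hU b⟩

theorem continuous_proj [TopologicalSpace Y] : Continuous (proj (T := T)) :=
  ⟨fun _ hU => isOpen_iff.2 fun _ => hU⟩

instance [TopologicalSpace Y] [T1Space Y] : T1Space (GluedDouble T) where
  t1 p := by
    rw [← isOpen_compl_iff, isOpen_iff]
    intro b
    rw [preimage_compl, isOpen_compl_iff]
    exact ((Set.subsingleton_singleton).preimage (chart_injective b)).isClosed

noncomputable instance [Semigroup Y] : Semigroup (GluedDouble T) where
  mul p q := chart T false (p.proj * q.proj)
  mul_assoc p q r := congrArg (chart T false) (mul_assoc p.proj q.proj r.proj)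

theorem mul_def [Semigroup Y] (p q : GluedDouble T) :
    p * q = chart T false (p.proj * q.proj) := rfl

instance [Semigroup Y] [TopologicalSpace Y] [ContinuousMul Y] :
    ContinuousMul (GluedDouble T) where
  continuous_mul := by
    simp only [mul_def]
    exact (continuous_chart false).comp
      ((continuous_proj.comp continuous_fst).mul (continuous_proj.comp continuous_snd))

/-- The first copy of `Y` is a subsemigroup of the double. -/
noncomputable def chartHom [Semigroup Y] (T : Set Y) : Y →ₙ* GluedDouble T where
  toFun := chart T false
  map_mul' _ _ := rfl

end GluedDouble

end Charts

namespace AbsolutelyT1SClosed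

variable {X : Type u} [Semigroup X]

/-- Every subset of the image of `X` is closed: double the points outside of it. -/
theorem isClosed_of_subset_range (hX : AbsolutelyT1SClosed X) {Y : Type u} [Semigroup Y]
    [TopologicalSpace Y] [ContinuousMul Y] [T1Space Y] (h : X →ₙ* Y) {S : Set Y}
    (hS : S ⊆ range h) : IsClosed S := by
  have key := (hX _ ((GluedDouble.chartHom Sᶜ).comp h)).preimage
    (GluedDouble.continuous_chart true)
  convert key using 1
  ext y
  refine Iff.trans ?_ (exists_congr fun x => (GluedDouble.chart_false_eq_chart_true).symm)
  rw [Set.mem_compl_iff, not_not]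
  constructor
  · intro hy
    obtain ⟨x, rfl⟩ := hS hy
    exact ⟨x, rfl, hy⟩
  · rintro ⟨x, -, hy⟩
    exact hy

theorem of_surjective (hX : AbsolutelyT1SClosed X) {Q : Type u} [Semigroup Q] (f : X →ₙ* Q)
    (hf : Function.Surjective f) : AbsolutelyT1SClosed Q := by
  intro Y _ _ _ _ h
  have := hX Y (h.comp f)
  rwa [MulHom.coe_comp, hf.range_comp] at this

/-- Homomorphic images in compact topological semigroups are finite. -/
theorem finite_range (hX : AbsolutelyT1SClosed X) {Y : Type u} [Semigroup Y]
    [TopologicalSpace Y] [ContinuousMul Y] [T1Space Y] [CompactSpace Y] (h : X →ₙ* Y) :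
    (range h).Finite := by
  refine ((hX Y h).isCompact).finite (isDiscrete_iff_discreteTopology.2 ?_)
  refine discreteTopology_iff_forall_isClosed.2 fun s => ?_
  have := hX.isClosed_of_subset_range h (S := Subtype.val '' s) (by rintro _ ⟨x, -, rfl⟩; exact x.2)
  rw [← Set.preimage_image_eq s Subtype.val_injective]
  exact this.preimage continuous_subtype_val

/-- The ideals of `X` satisfy the descending chain condition. -/
theorem wellFounded_ideals (hX : AbsolutelyT1SClosed X) :
    WellFounded ((· < ·) : {I : Set X // IsIdealSet X I} → {I : Set X // IsIdealSet X I} → Prop) := by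
  rw [wellFounded_iff_isEmpty_descending_chain]
  refine ⟨fun ⟨f, hf⟩ => ?_⟩
  have hanti : Antitone f := antitone_nat_of_succ_le fun n => (hf n).le
  have hex : ∀ n, ∃ x, x ∈ (f n).1 ∧ x ∉ (f (n + 1)).1 := fun n =>
    Set.exists_of_ssubset (hf n)
  choose x hx hx' using hex
  let : ∀ n, TopologicalSpace (ReesCon (f n).1 (f n).2).Quotient := fun n => ⊥
  have : ∀ n, DiscreteTopology (ReesCon (f n).1 (f n).2).Quotient := fun n => ⟨rfl⟩
  let h : X →ₙ* ∀ n, (ReesCon (f n).1 (f n).2).Quotient :=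
    { toFun := fun a n => (a : (ReesCon (f n).1 (f n).2).Quotient)
      map_mul' := fun _ _ => rfl }
  have hclosed : IsClosed (range (h ∘ x)) :=
    hX.isClosed_of_subset_range h (range_comp_subset_range x h)
  have hlim : Tendsto (h ∘ x) atTop (𝓝 fun n => (x n : (ReesCon (f n).1 (f n).2).Quotient)) := by
    refine tendsto_pi_nhds.2 fun n => tendsto_const_nhds.congr' ?_
    filter_upwards [eventually_ge_atTop n] with m hm
    exact (Con.eq _).2 (Or.inr ⟨hx n, hanti hm (hx m)⟩)
  obtain ⟨m, hm⟩ := hclosed.mem_of_tendsto hlim (Eventually.of_forall fun n => mem_range_self n)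
  rcases (Con.eq _).1 (congrFun hm (m + 1)) with he | he
  · exact hx' m (he ▸ hx (m + 1))
  · exact hx' m he.1

end AbsolutelyT1SClosed

section UltrafilterExtension

attribute [local instance] Ultrafilter.semigroup

variable {X : Type u} [Semigroup X]

theorem Ultrafilter.mem_mul_iff (p q : Ultrafilter X) (s : Set X) :
    s ∈ p * q ↔ {a | {b | a * b ∈ s} ∈ q} ∈ p := Iff.rfl

theorem Ultrafilter.eq_pure_of_singleton_mem {M : Type*} {p : Ultrafilter M} {a : M} (h : {a} ∈ p) :
    p = pure a := by
  obtain ⟨_, rfl, hb⟩ := Ultrafilter.eq_pure_of_finite_mem (finite_singleton a) h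
  exact hb

theorem Ultrafilter.isOpen_singleton_pure {M : Type*} (a : M) :
    IsOpen {(pure a : Ultrafilter M)} := by
  convert ultrafilter_isOpen_basic {a} using 1
  ext p
  refine ⟨fun h => ?_, fun h => ?_⟩
  · rw [Set.mem_singleton_iff.1 h]; exact Set.mem_singleton a
  · exact Ultrafilter.eq_pure_of_singleton_mem h

theorem Ultrafilter.continuous_pure_mul (a : X) :
    Continuous fun q : Ultrafilter X => pure a * q :=
  ultrafilterBasis_is_basis.continuous_iff.2 <| Set.forall_mem_range.mpr fun s =>
    ultrafilter_isOpen_basic {b | a * b ∈ s}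

/-- The ultrafilters which are principal or contain a given ideal. -/
def ultrafilterExtension (S : Set X) (hS : IsIdealSet X S) : Subsemigroup (Ultrafilter X) where
  carrier := {p | (∃ a, p = pure a) ∨ S ∈ p}
  mul_mem' := by
    rintro p q hp (⟨b, rfl⟩ | hq)
    · rcases hp with ⟨a, rfl⟩ | hp
      · exact Or.inl ⟨a * b, rfl⟩
      · exact Or.inr ((Ultrafilter.mem_mul_iff _ _ _).2 (mem_of_superset (show S ∈ p from hp)
          fun s hs => (hS s hs b).1))
    · exact Or.inr ((Ultrafilter.mem_mul_iff _ _ _).2 (univ_mem' fun a =>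
        mem_of_superset (show S ∈ q from hq) fun s hs => (hS s hs a).2))

theorem continuousMul_ultrafilterExtension {S : Set X} {hS : IsIdealSet X S} {c : X}
    (hc : ∀ s ∈ S, ∀ t ∈ S, s * t = c) : ContinuousMul (ultrafilterExtension S hS) := by
  refine ⟨continuous_induced_rng.2 (continuous_iff_continuousAt.2 ?_)⟩
  rintro ⟨⟨p, hp⟩, ⟨q, hq⟩⟩
  have hfst : Continuous fun z : ultrafilterExtension S hS × ultrafilterExtension S hS =>
    (z.1 : Ultrafilter X) := continuous_subtype_val.comp continuous_fst
  have hsnd : Continuous fun z : ultrafilterExtension S hS × ultrafilterExtension S hS =>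
    (z.2 : Ultrafilter X) := continuous_subtype_val.comp continuous_snd
  by_cases hp' : ∃ a, p = pure a
  · obtain ⟨a, rfl⟩ := hp'
    refine ((Ultrafilter.continuous_pure_mul a).comp hsnd).continuousAt.congr ?_
    filter_upwards [((Ultrafilter.isOpen_singleton_pure a).preimage hfst).mem_nhds rfl] with z hz
    exact congrArg (· * (z.2 : Ultrafilter X)) (Eq.symm hz)
  by_cases hq' : ∃ a, q = pure a
  · obtain ⟨a, rfl⟩ := hq'
    refine ((Ultrafilter.continuous_mul_left (pure a)).comp hfst).continuousAt.congr ?_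
    filter_upwards [((Ultrafilter.isOpen_singleton_pure a).preimage hsnd).mem_nhds rfl] with z hz
    exact congrArg ((z.1 : Ultrafilter X) * ·) (Eq.symm hz)
  have hmul : ∀ p q : Ultrafilter X, S ∈ p → S ∈ q → p * q = pure c := fun p q hp hq =>
    Ultrafilter.eq_pure_of_singleton_mem ((Ultrafilter.mem_mul_iff _ _ _).2
      (mem_of_superset hp fun s hs => mem_of_superset hq fun t ht => hc s hs t ht))
  refine (continuousAt_const (y := (pure c : Ultrafilter X))).congr ?_
  filter_upwards [((ultrafilter_isOpen_basic S).preimage hfst).mem_nhds (hp.resolve_left hp'),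
    ((ultrafilter_isOpen_basic S).preimage hsnd).mem_nhds (hq.resolve_left hq')] with z hz hz'
  exact (hmul _ _ hz hz').symm

theorem AbsolutelyT1SClosed.finite_of_mul_eq_const (hX : AbsolutelyT1SClosed X) {S : Set X}
    (hS : IsIdealSet X S) {c : X} (hc : ∀ s ∈ S, ∀ t ∈ S, s * t = c) : S.Finite := by
  by_contra hinf
  have : NeBot (cofinite ⊓ 𝓟 S) := Set.Infinite.cofinite_inf_principal_neBot hinf
  let p := Ultrafilter.of (cofinite ⊓ 𝓟 S)
  have hp : S ∈ p := (Ultrafilter.of_le _) (mem_inf_of_right (mem_principal_self S))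
  have := continuousMul_ultrafilterExtension (hS := hS) hc
  let h : X →ₙ* ultrafilterExtension S hS :=
    { toFun := fun a => ⟨pure a, Or.inl ⟨a, rfl⟩⟩
      map_mul' := fun _ _ => rfl }
  have hlim : Tendsto h p (𝓝 ⟨p, Or.inr hp⟩) :=
    tendsto_subtype_rng.2 (Ultrafilter.tendsto_pure_self p)
  obtain ⟨a, ha⟩ := (hX _ h).mem_of_tendsto hlim (Eventually.of_forall fun a => mem_range_self a)
  have ha' : p = pure a := (congrArg Subtype.val ha).symm
  have h1 : ({a}ᶜ : Set X) ∈ p :=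
    (Ultrafilter.of_le _) (mem_inf_of_left (Set.finite_singleton a).compl_mem_cofinite)
  rw [ha'] at h1
  exact h1 rfl

end UltrafilterExtension

theorem isIdealSet_mul {X : Type*} [Semigroup X] {J : Set X} (hJ : IsIdealSet X J) :
    IsIdealSet X {a | ∃ s ∈ J, ∃ t ∈ J, a = s * t} := by
  rintro _ ⟨s, hs, t, ht, rfl⟩ y
  exact ⟨⟨s, hs, t * y, (hJ t ht y).1, mul_assoc _ _ _⟩,
    ⟨y * s, (hJ s hs y).2, t, ht, (mul_assoc _ _ _).symm⟩⟩

theorem AbsolutelyT1SClosed.finite_diff_mul {X : Type u} [Semigroup X]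
    (hX : AbsolutelyT1SClosed X) {J : Set X} (hJ : IsIdealSet X J) :
    (J \ {a | ∃ s ∈ J, ∃ t ∈ J, a = s * t}).Finite := by
  rcases J.eq_empty_or_nonempty with rfl | ⟨j, hj⟩
  · simp
  set c := ReesCon _ (isIdealSet_mul hJ) with hc
  let f : X →ₙ* c.Quotient := { toFun := fun a => (a : c.Quotient), map_mul' := fun _ _ => rfl }
  have hf : Function.Surjective f := Quotient.mk''_surjective
  have hfin : (f '' J).Finite := by
    refine (hX.of_surjective f hf).finite_of_mul_eq_const (c := f (j * j)) ?_ ?_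
    · rintro _ ⟨s, hs, rfl⟩ y
      obtain ⟨y, rfl⟩ := hf y
      exact ⟨⟨s * y, (hJ s hs y).1, rfl⟩, ⟨y * s, (hJ s hs y).2, rfl⟩⟩
    · rintro _ ⟨s, hs, rfl⟩ _ ⟨t, ht, rfl⟩
      exact (Con.eq c).2 (Or.inr ⟨⟨s, hs, t, ht, rfl⟩, ⟨j, hj, j, hj, rfl⟩⟩)
  refine Set.Finite.of_finite_image (f := f) (hfin.subset (image_mono sdiff_subset)) ?_
  rintro a ha b hb hab
  rcases (Con.eq c).1 hab with h | h
  · exact h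
  · exact absurd h.1 ha.2

section Powers

variable {X : Type*} [Semigroup X]

theorem spow_mem_centerSet {z : X} (hz : z ∈ centerSet X) (n : ℕ) : spow z n ∈ centerSet X := by
  induction n with
  | zero => exact hz
  | succ n ih => exact centerSet_mul_mem ih hz

theorem spow_mul_of_mem_centerSet {w : X} (hw : w ∈ centerSet X) (y : X) (n : ℕ) :
    spow (w * y) n = spow w n * spow y n := by
  induction n with
  | zero => rfl
  | succ n ih =>
    simp only [spow, ih]
    rw [mul_assoc, mul_assoc, ← mul_assoc (spow y n) w y, ← hw (spow y n), mul_assoc]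

theorem spow_mul_spow (z : X) (m n : ℕ) : spow z m * spow z n = spow z (m + n + 1) := by
  induction n with
  | zero => rfl
  | succ n ih => rw [spow, ← mul_assoc, ih]; rfl

theorem isIdealSet_univ : IsIdealSet X Set.univ := fun _ _ _ => ⟨trivial, trivial⟩

/-- The ideal generated by a set of central elements. -/
theorem isIdealSet_span {B : Set X} (hB : B ⊆ centerSet X) :
    IsIdealSet X {a | a ∈ B ∨ ∃ x, ∃ b ∈ B, a = x * b} := by
  rintro a (ha | ⟨x, b, hb, rfl⟩) y
  · exact ⟨Or.inr ⟨y, a, ha, hB ha y⟩, Or.inr ⟨y, a, ha, rfl⟩⟩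
  · exact ⟨Or.inr ⟨x * y, b, hb, by rw [mul_assoc, hB hb y, mul_assoc]⟩,
      Or.inr ⟨y * x, b, hb, (mul_assoc _ _ _).symm⟩⟩

theorem isIdealSet_mul_left {w : X} (hw : w ∈ centerSet X) {J : Set X} (hJ : IsIdealSet X J) :
    IsIdealSet X {a | ∃ j ∈ J, a = w * j} := by
  rintro _ ⟨j, hj, rfl⟩ y
  exact ⟨⟨j * y, (hJ j hj y).1, mul_assoc _ _ _⟩,
    ⟨y * j, (hJ j hj y).2, by rw [← mul_assoc, ← hw y, mul_assoc]⟩⟩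

/-- An element divisible by itself times a central element `m` is divisible by all powers
of `m`. -/
theorem exists_eq_spow_mul {m c y : X} (hm : m ∈ centerSet X) (hc : c = m * (y * c)) (n : ℕ) :
    ∃ y', c = spow m n * (y' * c) := by
  induction n with
  | zero => exact ⟨y, hc⟩
  | succ n ih =>
    obtain ⟨y', hy'⟩ := ih
    refine ⟨y' * y, ?_⟩
    calc c = spow m n * (y' * (m * (y * c))) := by rw [← hc, ← hy']
      _ = spow m n * m * (y' * y * c) := by
        rw [← mul_assoc y' m, ← hm y']; simp only [mul_assoc]

end Powers

namespace AbsolutelyT1SClosed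

variable {X : Type u} [Semigroup X]

/-- Outside of an ideal there are only finitely many central elements some power of which lies
in this ideal. -/
theorem finite_sqrt_diff (hX : AbsolutelyT1SClosed X) {I : Set X} (hI : IsIdealSet X I) :
    ((centerSet X ∩ sqrtSet X I) \ I).Finite := by
  by_contra hinf
  set N := (centerSet X ∩ sqrtSet X I) \ I with hN
  obtain ⟨⟨J, hJ⟩, hJinf, hmin⟩ := hX.wellFounded_ideals.has_min {J | (J.1 ∩ N).Infinite}
    ⟨⟨univ, isIdealSet_univ⟩, by simpa using hinf⟩
  have hmin' : ∀ K, IsIdealSet X K → K ⊆ J → (K ∩ N).Infinite → J ⊆ K := by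
    intro K hK hKJ hKinf
    by_contra hJK
    exact hmin ⟨K, hK⟩ hKinf ⟨hKJ, hJK⟩
  have hcent : J ∩ N ⊆ centerSet X := fun z hz => hz.2.1.1
  have hspan : ∀ B ⊆ J ∩ N, B.Infinite → ∀ a ∈ J, a ∈ B ∨ ∃ x, ∃ b ∈ B, a = x * b := by
    intro B hB hBinf
    refine hmin' _ (isIdealSet_span (hB.trans hcent)) ?_ (hBinf.mono fun b hb => ⟨Or.inl hb, (hB hb).2⟩)
    rintro a (ha | ⟨x, b, hb, rfl⟩)
    · exact (hB ha).1
    · exact (hJ b (hB hb).1 x).2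
  have hsq : ∀ a ∈ J, ∃ s ∈ J, ∃ t ∈ J, a = s * t := by
    refine hmin' _ (isIdealSet_mul hJ) ?_ fun hfin => hJinf ?_
    · rintro _ ⟨s, hs, t, -, rfl⟩
      exact (hJ s hs t).1
    · refine ((hX.finite_diff_mul hJ).union hfin).subset fun a ha => ?_
      by_cases h : ∃ s ∈ J, ∃ t ∈ J, a = s * t
      · exact Or.inr ⟨h, ha.2⟩
      · exact Or.inl ⟨ha.1, h⟩
  have hfin : ∀ w ∈ J ∩ N, ({a | ∃ j ∈ J, a = w * j} ∩ N).Finite := by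
    intro w hw
    by_contra hwinf
    have hdiv := hmin' _ (isIdealSet_mul_left (hcent hw) hJ)
      (by rintro _ ⟨j, hj, rfl⟩; exact (hJ j hj w).2) hwinf
    have hdiv' : ∀ n, ∀ j ∈ J, ∃ j' ∈ J, j = spow w n * j' := by
      intro n
      induction n with
      | zero => exact hdiv
      | succ n ih =>
        intro j hj
        obtain ⟨j', hj', rfl⟩ := ih j hj
        obtain ⟨k, hk, rfl⟩ := hdiv hj'
        exact ⟨k, hk, (mul_assoc _ _ _).symm⟩
    obtain ⟨n, hn⟩ := hw.2.1.2
    obtain ⟨j, -, hj⟩ := hdiv' n w hw.1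
    exact hw.2.2 (hj ▸ (hI _ hn j).1)
  have hexists : ∀ w ∈ J ∩ N, ∃ B ⊆ J ∩ N, B.Infinite ∧ ∀ y ∈ B, w * y ∈ I := by
    intro w hw
    by_contra! hB
    have hB0 : ((J ∩ N) ∩ {y | w * y ∈ I}).Finite := by
      by_contra h
      obtain ⟨y, hy, hy'⟩ := hB _ inter_subset_left h
      exact hy' hy.2
    have hinf' : ((J ∩ N) \ {y | w * y ∈ I}).Infinite := fun h =>
      hJinf ((hB0.union h).subset (inter_union_sdiff _ _).ge)
    refine hinf' (Set.Finite.of_finite_fibers (w * ·) ((hfin w hw).subset ?_) ?_)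
    · rintro _ ⟨y, ⟨hy, hyI⟩, rfl⟩
      obtain ⟨n, hn⟩ := hy.2.1.2
      refine ⟨⟨y, hy.1, rfl⟩, ⟨centerSet_mul_mem (hcent hw) (hcent hy), n, ?_⟩, hyI⟩
      rw [spow_mul_of_mem_centerSet (hcent hw)]
      exact (hI _ hn _).2
    · intro c _
      by_contra hcinf
      set B := ((J ∩ N) \ {y | w * y ∈ I}) ∩ (w * ·) ⁻¹' {c} with hBdef
      obtain ⟨z, ⟨hz, hzI⟩, hzc⟩ := Set.Infinite.nonempty hcinf
      have hBc : ∀ y ∈ B, w * y = c := fun y hy => hy.2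
      have hwz : w * z = c := hzc
      obtain ⟨s, hs, t, ht, rfl⟩ := hsq z hz.1
      have ht' : ∃ x, w * t = x * c ∨ w * t = c := by
        rcases hspan B (fun y hy => hy.1.1) hcinf t ht with htB | ⟨x, b, hb, rfl⟩
        · exact ⟨t, Or.inr (hBc t htB)⟩
        · refine ⟨x, Or.inl ?_⟩
          rw [← mul_assoc, hcent hw x, mul_assoc, hBc b hb]
      have hc : c = s * (w * t) := by rw [← hwz, ← mul_assoc, hcent hw s, mul_assoc]
      have key : ∃ m ∈ J ∩ N, ∃ y, c = m * (y * c) := by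
        obtain ⟨m, hm, hms⟩ : ∃ m ∈ J ∩ N, ∀ k, s * k = m * k ∨ ∃ x, s * k = m * (x * k) := by
          rcases hspan _ Subset.rfl hJinf s hs with hsM | ⟨x, m, hm, rfl⟩
          · exact ⟨s, hsM, fun k => Or.inl rfl⟩
          · exact ⟨m, hm, fun k => Or.inr ⟨x, by rw [← hcent hm x, mul_assoc]⟩⟩
        refine ⟨m, hm, ?_⟩
        obtain ⟨x, hx | hx⟩ := ht'
        · rcases hms (w * t) with h | ⟨x', h⟩
          · exact ⟨x, by rw [← hx, ← h, ← hc]⟩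
          · exact ⟨x' * x, by rw [mul_assoc, ← hx, ← h, ← hc]⟩
        · rcases hms (w * t) with h | ⟨x', h⟩
          · have : c = m * c := by rw [← hx, ← h, ← hc, hx]
            exact ⟨m, by rw [← this, ← this]⟩
          · exact ⟨x', by rw [← hx, ← h, ← hc, hx]⟩
      obtain ⟨m, hm, y, hy⟩ := key
      obtain ⟨n, hn⟩ := hm.2.1.2
      obtain ⟨y', hy'⟩ := exists_eq_spow_mul (hcent hm) hy n
      refine hzI ?_
      rw [Set.mem_ofPred_eq, hwz, hy']
      exact (hI _ hn _).1
  have hann : ∀ w ∈ J ∩ N, ∀ a ∈ J, w * a ∈ I := by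
    intro w hw a ha
    obtain ⟨B, hB, hBinf, hBI⟩ := hexists w hw
    rcases hspan B hB hBinf a ha with haB | ⟨x, b, hb, rfl⟩
    · exact hBI a haB
    · rw [← mul_assoc, hcent hw x, mul_assoc]
      exact (hI _ (hBI b hb) x).2
  obtain ⟨a, ha⟩ := hJinf.nonempty
  obtain ⟨s, hs, t, ht, rfl⟩ := hsq a ha.1
  rcases hspan _ Subset.rfl hJinf s hs with hsM | ⟨x, m, hm, rfl⟩
  · exact ha.2.2 (hann s hsM t ht)
  · rw [mul_assoc] at ha
    exact ha.2.2 (hI _ (hann m hm t ht) x).2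

/-- Every central element has a power dividing its own square in the strong sense. -/
theorem exists_spow_eq_mul_self_mul (hX : AbsolutelyT1SClosed X) {z : X}
    (hz : z ∈ centerSet X) : ∃ n w, spow z n = spow z n * spow z n * w := by
  have hid := fun n => isIdealSet_span (singleton_subset_iff.2 (spow_mem_centerSet hz n))
  obtain ⟨_, ⟨n, rfl⟩, hmin⟩ := hX.wellFounded_ideals.has_min (range fun n => ⟨_, hid n⟩)
    (range_nonempty _)
  have hsq := spow_mul_spow z n n
  have hle := not_lt_iff_le_imp_ge.1 (hmin _ ⟨n + n + 1, rfl⟩) (by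
    rintro a (rfl | ⟨x, _, rfl, rfl⟩)
    · exact Or.inr ⟨_, _, rfl, hsq.symm⟩
    · exact Or.inr ⟨x * spow z n, _, rfl, by rw [mul_assoc, hsq]⟩)
  refine ⟨n, ?_⟩
  rw [hsq]
  rcases hle (Or.inl rfl) with h | ⟨x, _, rfl, h⟩
  · refine ⟨spow z (n + n + 1), ?_⟩
    have h' : spow z n = spow z (n + n + 1) := h
    rw [← h', hsq, ← h']
  · exact ⟨x, h.trans (spow_mem_centerSet hz _ x).symm⟩

end AbsolutelyT1SClosed

section Bohr

/-- Real characters separate points from subgroups. -/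
theorem AddSubgroup.exists_character_ne_zero {A : Type*} [AddCommGroup A] (H : AddSubgroup A)
    {a : A} (ha : a ∉ H) :
    ∃ χ : A →+ AddCircle (1 : ℝ), (∀ x ∈ H, χ x = 0) ∧ χ a ≠ 0 := by
  have ha' : (a : A ⧸ H) ≠ 0 := by rwa [Ne, QuotientAddGroup.eq_zero_iff]
  obtain ⟨c, hc⟩ := CharacterModule.exists_character_apply_ne_zero_of_ne_zero ha'
  let castHom : AddCircle (1 : ℚ) →+ AddCircle (1 : ℝ) :=
    QuotientAddGroup.map _ _ (Rat.castHom ℝ).toAddMonoidHom (by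
      rw [AddSubgroup.zmultiples_le]
      exact ⟨1, by simp⟩)
  have hcast : Function.Injective castHom := by
    rw [injective_iff_map_eq_zero]
    rintro ⟨q⟩ hq
    obtain ⟨n, hn⟩ := (QuotientAddGroup.eq_zero_iff _).1 hq
    refine (QuotientAddGroup.eq_zero_iff _).2 ⟨n, ?_⟩
    have : (n : ℝ) = q := by simpa using hn
    have : (n : ℚ) = q := by exact_mod_cast this
    simpa using this
  refine ⟨castHom.comp ((c : (A ⧸ H) →+ AddCircle (1 : ℚ)).comp (QuotientAddGroup.mk' H)),
    fun x hx => ?_, fun h => hc ?_⟩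
  · have : QuotientAddGroup.mk' H x = 0 := (QuotientAddGroup.eq_zero_iff x).2 hx
    change castHom (c (QuotientAddGroup.mk' H x)) = 0
    rw [this, map_zero, map_zero]
  · exact (injective_iff_map_eq_zero castHom).1 hcast _ h

/-- The Bohr topology of an abelian group: all subgroups are closed, and only finite groups are
discrete. -/
theorem exists_bohr_topology (A : Type*) [AddCommGroup A] :
    ∃ _ : TopologicalSpace A, IsTopologicalAddGroup A ∧
      (∀ H : AddSubgroup A, IsClosed (H : Set A)) ∧ (DiscreteTopology A → Finite A) := by
  let φ : A →+ (A →+ AddCircle (1 : ℝ)) → AddCircle (1 : ℝ) :=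
    { toFun := fun a χ => χ a
      map_zero' := funext fun χ => map_zero χ
      map_add' := fun a b => funext fun χ => map_add χ a b }
  have : Fact ((0 : ℝ) < 1) := ⟨one_pos⟩
  let τ : TopologicalSpace A := TopologicalSpace.induced φ inferInstance
  have hφ : IsInducing φ := ⟨rfl⟩
  have hcont (χ : A →+ AddCircle (1 : ℝ)) : Continuous χ :=
    (continuous_apply χ).comp hφ.continuous
  refine ⟨τ, topologicalAddGroup_induced φ, fun H => ?_, fun hd => ?_⟩
  · have : (H : Set A) = ⋂ χ : {χ : A →+ AddCircle (1 : ℝ) // ∀ x ∈ H, χ x = 0},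
        χ.1 ⁻¹' {0} := by
      ext a
      simp only [SetLike.mem_coe, mem_iInter, mem_preimage, mem_singleton_iff, Subtype.forall]
      refine ⟨fun ha χ hχ => hχ a ha, fun h => ?_⟩
      by_contra ha
      obtain ⟨χ, hχ, hne⟩ := H.exists_character_ne_zero ha
      exact hne (h χ hχ)
    rw [this]
    exact isClosed_iInter fun χ => isClosed_singleton.preimage (hcont χ.1)
  · have hinj : Function.Injective φ := by
      rw [injective_iff_map_eq_zero]
      intro a ha
      by_contra hne
      obtain ⟨χ, -, hχ⟩ := (⊥ : AddSubgroup A).exists_character_ne_zero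
        (a := a) (by rwa [AddSubgroup.mem_bot])
      exact hχ (congrFun ha χ)
    have : DiscreteTopology φ.range :=
      (IsEmbedding.toHomeomorph ⟨hφ, hinj⟩).symm.isEmbedding.discreteTopology
    have hcl := AddSubgroup.isClosed_of_discrete (H := φ.range)
    have hfin : (Set.range φ).Finite :=
      hcl.isCompact.finite (isDiscrete_iff_discreteTopology.2 this)
    exact Set.finite_range_iff hinj |>.1 hfin

end Bohr

section MaxSubgroup

variable {X : Type*} [Semigroup X]

theorem mul_mem_maxSubgroup {e x y : X} (hx : x ∈ maxSubgroup X e) (hy : y ∈ maxSubgroup X e) :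
    x * y ∈ maxSubgroup X e := by
  obtain ⟨hxe, hex, x', hxe', hex', hxx', hx'x⟩ := hx
  obtain ⟨hye, hey, y', hye', hey', hyy', hy'y⟩ := hy
  refine ⟨by rw [mul_assoc, hye], by rw [← mul_assoc, hex], y' * x', ?_, ?_, ?_, ?_⟩
  · rw [mul_assoc, hxe']
  · rw [← mul_assoc, hey']
  · rw [mul_assoc, ← mul_assoc y, hyy', hex', hxx']
  · rw [mul_assoc, ← mul_assoc x', hx'x, hey, hy'y]

theorem eq_of_mem_maxSubgroup_of_mem_idemSet {e x : X} (hx : x ∈ maxSubgroup X e)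
    (hxx : x ∈ idemSet X) : x = e := by
  obtain ⟨hxe, -, y, -, -, hxy, -⟩ := hx
  calc x = x * x * y := by rw [mul_assoc, hxy, hxe]
    _ = e := by rw [show x * x = x from hxx, hxy]

theorem mul_mem_HeCoideal {e x y : X} (hx : x ∈ HeCoideal X e) (hy : y ∈ HeCoideal X e) :
    x * y ∈ HeCoideal X e := by
  refine ⟨by rw [mul_assoc, hy.1, ← mul_assoc, hx.1, mul_assoc], ?_⟩
  have : x * y * e = x * e * (y * e) := by rw [mul_assoc x e, hy.2.2.1, mul_assoc]
  rw [this]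
  exact mul_mem_maxSubgroup hx.2 hy.2

theorem mul_mem_HeCoideal_iff {e x y : X} (he : e ∈ viableIdems X) :
    x * y ∈ HeCoideal X e ↔ x ∈ HeCoideal X e ∧ y ∈ HeCoideal X e := by
  refine ⟨fun h => ⟨?_, ?_⟩, fun h => mul_mem_HeCoideal h.1 h.2⟩
  · by_contra hx
    exact (he.2 x ⟨trivial, hx⟩ y).1.2 h
  · by_contra hy
    exact (he.2 y ⟨trivial, hy⟩ x).2.2 h

theorem mem_HeCoideal_self {e : X} (he : e ∈ idemSet X) : e ∈ HeCoideal X e := by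
  have h : e * e = e := he
  exact ⟨rfl, by rw [h]; exact ⟨h, h, e, h, h, h, h⟩⟩

theorem mul_eq_of_mem_HeCoideal {e f : X} (he : e ∈ idemSet X) (hf : f ∈ idemSet X)
    (hfe : f ∈ HeCoideal X e) : f * e = e := by
  refine eq_of_mem_maxSubgroup_of_mem_idemSet hfe.2 ?_
  change f * e * (f * e) = f * e
  rw [mul_assoc, ← mul_assoc e f, ← hfe.1, mul_assoc f e e, show e * e = e from he, ← mul_assoc,
    show f * f = f from hf]

/-- A central element lies in the maximal subgroup at `e` as soon as it is fixed by `e` and one of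
its powers lies there. -/
theorem mem_maxSubgroup_of_spow_mem {e z : X} (hz : z ∈ centerSet X) (hez : e * z = z) {n : ℕ}
    (h : spow z n ∈ maxSubgroup X e) : z ∈ maxSubgroup X e := by
  cases n with
  | zero => exact h
  | succ n =>
    obtain ⟨-, -, y, hye, hey, hzy, hyz⟩ := h
    have hze : z * e = z := by rw [hz e, hez]
    have hn : z * spow z n = spow z (n + 1) := hz _
    have hcomm : z * (spow z n * y) = spow z n * y * z := hz _
    have hprod : z * (spow z n * y) = e := by rw [← mul_assoc, hn, hzy]
    refine ⟨hze, hez, spow z n * y, by rw [mul_assoc, hye], ?_, hprod, by rw [← hcomm, hprod]⟩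
    rw [← mul_assoc, ← spow_mem_centerSet hz n e, mul_assoc, hey]

end MaxSubgroup

namespace AbsolutelyT1SClosed

variable {X : Type u} [Semigroup X]

/-- Central subgroups are finite: otherwise the Bohr topology of an infinite one induces a
`T₁` semigroup topology on `X` which is not discrete. -/
theorem finite_of_central_group (hX : AbsolutelyT1SClosed X) {A : Type*} [AddCommGroup A]
    (ι : A → X) (hinj : Function.Injective ι) (hadd : ∀ a b, ι (a + b) = ι a * ι b)
    (hcen : ∀ a, ι a ∈ centerSet X) : Finite A := by
  obtain ⟨τ, _, hH, hfin⟩ := exists_bohr_topology A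
  refine hfin ?_
  have hact (a b : A) (x : X) : ι a * (ι b * x) = ι (a + b) * x := by rw [hadd, mul_assoc]
  have hzero {c : A} {x y : X} (h : ι c * x = y) : ι 0 * y = y := by
    rw [← h, hact, zero_add]
  have hstab {c d : A} {x y : X} (hc : ι c * x = y) : ι d * x = y ↔ ι (d - c) * y = y := by
    conv_rhs => rw [← hc, hact, sub_add_cancel, hc]
  let σ : TopologicalSpace X := ⨆ x, TopologicalSpace.coinduced (fun c => ι c * x) τ
  have hopen {U : Set X} : IsOpen U ↔ ∀ x, IsOpen {c | ι c * x ∈ U} := isOpen_iSup_iff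
  have : T1Space X := by
    refine ⟨fun p => ?_⟩
    rw [← isOpen_compl_iff, hopen]
    intro x
    by_cases hex : ∃ c, ι c * x = p
    · obtain ⟨c, hc⟩ := hex
      let S : AddSubgroup A :=
        { carrier := {d | ι d * p = p}
          zero_mem' := hzero hc
          add_mem' := fun {a b} ha hb => by
            change ι (a + b) * p = p
            rw [← hact, hb, ha]
          neg_mem' := fun {a} ha => by
            change ι (-a) * p = p
            conv_lhs => rw [← show ι a * p = p from ha, hact, neg_add_cancel, hzero hc] }
      have : {d | ι d * x ∈ ({p} : Set X)ᶜ} = ((fun d => d - c) ⁻¹' (S : Set A))ᶜ := by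
        ext d
        exact not_congr (hstab hc)
      rw [this, isOpen_compl_iff]
      exact (hH S).preimage (by fun_prop)
    · convert isOpen_univ
      rw [eq_univ_iff_forall]
      exact fun c hc => hex ⟨c, hc⟩
  have hiso {x : X} (hx : ι 0 * x ≠ x) : IsOpen {x} := by
    rw [hopen]
    intro y
    convert isOpen_empty
    rw [eq_empty_iff_forall_notMem]
    exact fun c hc => hx (hzero hc)
  have hnhd {W : Set A} (hW : IsOpen W) (h0 : (0 : A) ∈ W) (x : X) :
      IsOpen {y | y = x ∨ ∃ w ∈ W, y = ι w * x} := by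
    rw [hopen]
    intro y
    rw [isOpen_iff_mem_nhds]
    intro c hc
    obtain ⟨w, hw, hcw⟩ : ∃ w ∈ W, ι c * y = ι w * x := by
      rcases hc with hc | hc
      · exact ⟨0, h0, by rw [hc, hzero hc]⟩
      · exact hc
    have : (fun d => d - c + w) ⁻¹' W ∈ 𝓝 c := by
      refine (hW.preimage (by fun_prop)).mem_nhds ?_
      simpa using hw
    filter_upwards [this] with d hd
    refine Or.inr ⟨_, hd, ?_⟩
    rw [← hact, ← hcw, hact, sub_add_cancel]
  have : ContinuousMul X := by
    refine ⟨continuous_iff_continuousAt.2 ?_⟩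
    rintro ⟨a, b⟩
    refine (nhds_basis_opens (a * b)).tendsto_right_iff.2 ?_
    rintro U ⟨hab, hU⟩
    rw [nhds_prod_eq]
    by_cases h0 : ι 0 * (a * b) = a * b
    · obtain ⟨W, hW, hW0, hWW⟩ := exists_open_nhds_zero_half
        ((hopen.1 hU (a * b)).mem_nhds (show ι 0 * (a * b) ∈ U by rwa [h0]))
      filter_upwards [prod_mem_prod ((hnhd hW hW0 a).mem_nhds (Or.inl rfl))
        ((hnhd hW hW0 b).mem_nhds (Or.inl rfl))]
      have hsw (w : A) (x y : X) : x * (ι w * y) = ι w * (x * y) := by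
        rw [← mul_assoc, ← hcen w x, mul_assoc]
      rintro ⟨x, y⟩ ⟨rfl | ⟨v, hv, rfl⟩, rfl | ⟨w, hw, rfl⟩⟩
      · exact hab
      · have : ι (w + 0) * (x * b) ∈ U := hWW w hw 0 hW0
        rwa [add_zero, ← hsw] at this
      · have : ι (v + 0) * (a * y) ∈ U := hWW v hv 0 hW0
        rwa [add_zero, ← mul_assoc] at this
      · have : ι (v + w) * (a * b) ∈ U := hWW v hv w hw
        rwa [← hact v w, ← hsw w a b, ← mul_assoc] at this
    · have ha : ι 0 * a ≠ a := fun h => h0 (by rw [← mul_assoc, h])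
      have hb : ι 0 * b ≠ b := fun h => h0 (by
        rw [← mul_assoc, hcen 0 a, mul_assoc, h])
      filter_upwards [prod_mem_prod ((hiso ha).mem_nhds rfl) ((hiso hb).mem_nhds rfl)]
      rintro ⟨x, y⟩ ⟨rfl, rfl⟩
      exact hab
  have hcl : IsClosed ({ι 0}ᶜ : Set X) :=
    hX.isClosed_of_subset_range (MulHom.id X) fun x _ => ⟨x, rfl⟩
  have h0 := hopen.1 (isClosed_compl_iff.1 hcl) (ι 0)
  refine discreteTopology_of_isOpen_singleton_zero ?_
  convert h0 using 1
  ext c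
  simp only [mem_singleton_iff, mem_ofPred_eq, ← hadd, add_zero, hinj.eq_iff]

theorem finite_maxSubgroup_inter_center (hX : AbsolutelyT1SClosed X) {e : X}
    (he : e ∈ idemSet X) (hec : e ∈ centerSet X) : (maxSubgroup X e ∩ centerSet X).Finite := by
  have hinv : ∀ x : ↥(maxSubgroup X e ∩ centerSet X), ∃ y : ↥(maxSubgroup X e ∩ centerSet X),
      y.1 * x.1 = e := by
    rintro ⟨x, ⟨hxe, hex, y, hye, hey, hxy, hyx⟩, hxc⟩
    refine ⟨⟨y, ⟨hye, hey, x, hxe, hex, hyx, hxy⟩, fun g => ?_⟩, hyx⟩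
    calc y * g = y * (x * g * y) := by rw [hxc g, mul_assoc, hxy, ← hec g, ← mul_assoc, hye]
      _ = g * y := by rw [← mul_assoc, ← mul_assoc, hyx, hec g, mul_assoc, hey]
  choose inv hinv using hinv
  let _ : CommGroup ↥(maxSubgroup X e ∩ centerSet X) :=
    { mul := fun x y => ⟨x.1 * y.1, mul_mem_maxSubgroup x.2.1 y.2.1,
        centerSet_mul_mem x.2.2 y.2.2⟩
      mul_assoc := fun x y z => Subtype.ext (mul_assoc _ _ _)
      one := ⟨e, ⟨he, he, e, he, he, he, he⟩, hec⟩
      one_mul := fun x => Subtype.ext x.2.1.2.1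
      mul_one := fun x => Subtype.ext x.2.1.1
      inv := inv
      inv_mul_cancel := fun x => Subtype.ext (hinv x)
      mul_comm := fun x y => Subtype.ext (x.2.2 y.1) }
  have : Finite (Additive ↥(maxSubgroup X e ∩ centerSet X)) :=
    hX.finite_of_central_group (fun a => (Additive.toMul a).1)
      (Subtype.val_injective.comp Additive.toMul.injective) (fun _ _ => rfl)
      (fun a => (Additive.toMul a).2.2)
  exact Set.finite_coe_iff.1 (Finite.of_equiv _ Additive.toMul)

open Classical in
/-- Viable central idempotents are separated by homomorphisms to the two-element semilattice, whose
product is compact. -/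
theorem finite_idemSet_inter_centerSet (hX : AbsolutelyT1SClosed X)
    (hviable : idemSet X ∩ centerSet X ⊆ viableIdems X) : (idemSet X ∩ centerSet X).Finite := by
  let h : X →ₙ* (↥(idemSet X ∩ centerSet X) → unitInterval) :=
    { toFun := fun x e => if x ∈ HeCoideal X e.1 then 1 else 0
      map_mul' := fun x y => funext fun e => by
        have := mul_mem_HeCoideal_iff (x := x) (y := y) (hviable e.2)
        by_cases hx : x ∈ HeCoideal X e.1 <;> by_cases hy : y ∈ HeCoideal X e.1 <;>
          simp [this, hx, hy] }
  have hmem {e f : X} (he : e ∈ idemSet X ∩ centerSet X) (hef : h e = h f) :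
      f ∈ HeCoideal X e := by
    by_contra hf
    have := congrFun hef ⟨e, he⟩
    simp [h, hf, mem_HeCoideal_self he.1] at this
  refine ((hX.finite_range h).subset (image_subset_range h _)).of_finite_image ?_
  intro e he f hf hef
  rw [← mul_eq_of_mem_HeCoideal he.1 hf.1 (hmem he hef), ← he.2 f,
    mul_eq_of_mem_HeCoideal hf.1 he.1 (hmem hf hef.symm)]

end AbsolutelyT1SClosed

theorem statement6 (X : Type u) [Semigroup X]
    (hviable : idemSet X ∩ centerSet X ⊆ viableIdems X)
    (hX : AbsolutelyT1SClosed X) : (centerSet X).Finite := by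
  have hideal : ∀ e ∈ centerSet X, IsIdealSet X {x | e * x = x} := by
    refine fun e he x hx y => ⟨?_, ?_⟩
    · change e * (x * y) = x * y
      rw [← mul_assoc, show e * x = x from hx]
    · change e * (y * x) = y * x
      rw [← mul_assoc, he y, mul_assoc, show e * x = x from hx]
  refine ((hX.finite_idemSet_inter_centerSet hviable).biUnion fun e he =>
    (hX.finite_sqrt_diff (hideal e he.2)).union
      (hX.finite_maxSubgroup_inter_center he.1 he.2)).subset fun z hz => ?_
  obtain ⟨n, w, hw⟩ := hX.exists_spow_eq_mul_self_mul hz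
  have huc := spow_mem_centerSet hz n
  set u := spow z n with hu
  set e := u * w with he
  have heu : e * u = u := by rw [← huc e, he, ← mul_assoc, ← hw]
  have hue : u * e = u := by rw [huc e, heu]
  have hee : e * e = e := by rw [he, ← mul_assoc, ← he, heu]
  have hec : e ∈ centerSet X := fun x => by
    calc e * x = w * (u * x) := by rw [he, huc w, mul_assoc]
      _ = w * (x * (u * e)) := by rw [huc x, hue]
      _ = e * x * e := by rw [← mul_assoc x, ← huc x, he, huc w]; simp only [mul_assoc]
      _ = e * u * x * w := by rw [mul_assoc e u, huc x, he]; simp only [mul_assoc]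
      _ = x * e := by rw [heu, huc x, he, mul_assoc]
  have hmem : u ∈ maxSubgroup X e := by
    refine ⟨hue, heu, w * e, by rw [mul_assoc, hee], ?_, ?_, ?_⟩
    · rw [← mul_assoc, hec w, mul_assoc, hee]
    · rw [← mul_assoc, ← he, hee]
    · rw [mul_assoc, heu, ← huc w, ← he]
  refine mem_biUnion (x := e) ⟨hee, hec⟩ ?_
  by_cases hze : e * z = z
  · exact Or.inr ⟨mem_maxSubgroup_of_spow_mem hz hze hmem, hz⟩
  · exact Or.inl ⟨⟨hz, n, heu⟩, hze⟩
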